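/- arXiv:math/0302142 — 5 statements merged into one kernel-verified Lean document; each statement's English description precedes it below -/
import Mathlib

section
/- For every n ≥ 0, (α/hₙ) ∫_{-1}^1 Pₙ(y)² (1−y)^{α−1} (1+y)^{β} dy = (β/hₙ) ∫_{-1}^1 Pₙ(y)² (1−y)^{α} (1+y)^{β−1} dy. Consequently, writing Rₙ for this common value, the rational function Aₙ(z) = (α/hₙ(1−z)) ∫_{-1}^1 Pₙ(y)²(1−y)^{α−1}(1+y)^{β} dy + (β/hₙ(1+z)) ∫_{-1}^1 Pₙ(y)²(1−y)^{α}(1+y)^{β−1} dy equals −Rₙ/(z−1) + Rₙ/(z+1) for all z ∉ {−1, 1}. -/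
open MeasureTheory Polynomial


/-- Orthogonality of `P n` to all polynomials of lower degree. -/
theorem jacobi_aux_orth
    (w : ℝ → ℝ) (hw : Continuous w)
    (P : ℕ → Polynomial ℝ)
    (hmonic : ∀ n, (P n).Monic) (hdeg : ∀ n, (P n).natDegree = n)
    (horth : ∀ m n : ℕ, m ≠ n →
      ∫ x in (-1 : ℝ)..1, (P m).eval x * (P n).eval x * w x = 0) (n : ℕ) :
    ∀ k : ℕ, k ≤ n → ∀ q : Polynomial ℝ, q.degree < k →
      ∫ x in (-1 : ℝ)..1, q.eval x * (P n).eval x * w x = 0 := by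
  intro k
  induction k with
  | zero =>
    intro _ q hq
    have hq0 : q = 0 := by
      rw [← Polynomial.degree_eq_bot]
      exact Nat.WithBot.lt_zero_iff.mp (by simpa using hq)
    simp [hq0]
  | succ k ih =>
    intro hk q hq
    have hr : (q - C (q.coeff k) * P k).degree < k := by
      rw [Polynomial.degree_lt_iff_coeff_zero] at hq ⊢
      intro m hm
      rcases Nat.eq_or_lt_of_le hm with rfl | hlt
      · have h1 : (P k).coeff k = 1 := by
          have := (hmonic k).coeff_natDegree
          rwa [hdeg k] at this
        simp [h1]
      · have h1 : (P k).coeff m = 0 :=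
          Polynomial.coeff_eq_zero_of_natDegree_lt (by rw [hdeg k]; exact hlt)
        simp [h1, hq m hlt]
    have h1 := ih (by omega) _ hr
    have h2 := horth k n (by omega)
    have h3 : ∀ x : ℝ, q.eval x * (P n).eval x * w x
        = (q - C (q.coeff k) * P k).eval x * (P n).eval x * w x
          + q.coeff k * ((P k).eval x * (P n).eval x * w x) := by
      intro x
      simp only [eval_sub, eval_mul, eval_C]
      ring
    simp_rw [h3]
    rw [intervalIntegral.integral_add, h1, intervalIntegral.integral_const_mul, h2]
    · simp
    · exact (((Polynomial.continuous _).mul (Polynomial.continuous _)).mul hw).intervalIntegrable _ _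
    · exact (continuous_const.mul
        (((Polynomial.continuous _).mul (Polynomial.continuous _)).mul hw)).intervalIntegrable _ _

/-- For the Jacobi weight `w(x) = (1-x)^α (1+x)^β` on `[-1,1]` with
`α, β > 0` and monic orthogonal polynomials `Pₙ`, for every `n ≥ 0` the quantity
`(α/hₙ) ∫ Pₙ² (1-y)^(α-1) (1+y)^β dy` equals `(β/hₙ) ∫ Pₙ² (1-y)^α (1+y)^(β-1) dy`;
writing `Rₙ` for this common value, the rational function
`Aₙ(z) = (α/hₙ(1-z)) ∫ Pₙ²(1-y)^(α-1)(1+y)^β + (β/hₙ(1+z)) ∫ Pₙ²(1-y)^α(1+y)^(β-1)`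
equals `-Rₙ/(z-1) + Rₙ/(z+1)` for all `z ∉ {-1, 1}`. -/
theorem jacobi_An_eval
    (α β : ℝ) (hα : 0 < α) (hβ : 0 < β)
    (P : ℕ → Polynomial ℝ)
    (hmonic : ∀ n, (P n).Monic) (hdeg : ∀ n, (P n).natDegree = n)
    (horth : ∀ m n : ℕ, m ≠ n →
      ∫ x in (-1 : ℝ)..1, (P m).eval x * (P n).eval x * ((1 - x) ^ α * (1 + x) ^ β) = 0)
    (h : ℕ → ℝ)
    (hh : ∀ n, h n = ∫ x in (-1 : ℝ)..1, ((P n).eval x) ^ 2 * ((1 - x) ^ α * (1 + x) ^ β)) :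
    ∀ n : ℕ,
      (α / h n) *
          (∫ y in (-1 : ℝ)..1, ((P n).eval y) ^ 2 * ((1 - y) ^ (α - 1) * (1 + y) ^ β))
        = (β / h n) *
          (∫ y in (-1 : ℝ)..1, ((P n).eval y) ^ 2 * ((1 - y) ^ α * (1 + y) ^ (β - 1)))
      ∧ ∀ z : ℝ, z ≠ 1 → z ≠ -1 →
          (α / (h n * (1 - z))) *
              (∫ y in (-1 : ℝ)..1, ((P n).eval y) ^ 2 * ((1 - y) ^ (α - 1) * (1 + y) ^ β))
            + (β / (h n * (1 + z))) *
              (∫ y in (-1 : ℝ)..1, ((P n).eval y) ^ 2 * ((1 - y) ^ α * (1 + y) ^ (β - 1)))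
          = -((β / h n) *
                (∫ y in (-1 : ℝ)..1, ((P n).eval y) ^ 2 * ((1 - y) ^ α * (1 + y) ^ (β - 1))))
              / (z - 1)
            + ((β / h n) *
                (∫ y in (-1 : ℝ)..1, ((P n).eval y) ^ 2 * ((1 - y) ^ α * (1 + y) ^ (β - 1))))
              / (z + 1) := by
  intro n
  have cα : Continuous (fun y : ℝ => (1 - y) ^ α) :=
    (continuous_const.sub continuous_id).rpow_const (fun _ => Or.inr hα.le)
  have cβ : Continuous (fun y : ℝ => (1 + y) ^ β) :=
    (continuous_const.add continuous_id).rpow_const (fun _ => Or.inr hβ.le)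
  have cP : Continuous (fun y : ℝ => (P n).eval y) := Polynomial.continuous _
  have cP' : Continuous (fun y : ℝ => (derivative (P n)).eval y) := Polynomial.continuous _
  have iα : IntervalIntegrable (fun y : ℝ => (1 - y) ^ (α - 1)) volume (-1) 1 := by
    have h0 := (intervalIntegral.intervalIntegrable_rpow' (a := 2) (b := 0)
      (r := α - 1) (by linarith)).comp_sub_left 1
    norm_num at h0
    exact h0
  have iβ : IntervalIntegrable (fun y : ℝ => (1 + y) ^ (β - 1)) volume (-1) 1 := by
    have h0 := (intervalIntegral.intervalIntegrable_rpow' (a := 0) (b := 2)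
      (r := β - 1) (by linarith)).comp_add_left 1
    norm_num at h0
    exact h0
  have jα : IntervalIntegrable
      (fun y : ℝ => ((P n).eval y) ^ 2 * ((1 - y) ^ (α - 1) * (1 + y) ^ β)) volume (-1) 1 :=
    (iα.mul_continuousOn cβ.continuousOn).continuousOn_mul (cP.pow 2).continuousOn
  have jβ : IntervalIntegrable
      (fun y : ℝ => ((P n).eval y) ^ 2 * ((1 - y) ^ α * (1 + y) ^ (β - 1))) volume (-1) 1 :=
    (iβ.continuousOn_mul cα.continuousOn).continuousOn_mul (cP.pow 2).continuousOn
  have jw : IntervalIntegrable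
      (fun y : ℝ => (derivative (P n)).eval y * (P n).eval y * ((1 - y) ^ α * (1 + y) ^ β))
      volume (-1) 1 := ((cP'.mul cP).mul (cα.mul cβ)).intervalIntegrable _ _
  have hort : ∫ y in (-1 : ℝ)..1,
      (derivative (P n)).eval y * (P n).eval y * ((1 - y) ^ α * (1 + y) ^ β) = 0 := by
    refine jacobi_aux_orth (fun y => (1 - y) ^ α * (1 + y) ^ β) (cα.mul cβ) P hmonic hdeg horth
      n n le_rfl _ ?_
    have h1 := Polynomial.degree_derivative_lt (hmonic n).ne_zero
    rwa [Polynomial.degree_eq_natDegree (hmonic n).ne_zero, hdeg n] at h1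
  have hftc := intervalIntegral.integral_eq_sub_of_hasDerivAt_of_le
    (a := (-1 : ℝ)) (b := 1)
    (f := fun y : ℝ => ((P n).eval y) ^ 2 * ((1 - y) ^ α * (1 + y) ^ β))
    (f' := fun y : ℝ =>
      2 * ((derivative (P n)).eval y * (P n).eval y * ((1 - y) ^ α * (1 + y) ^ β))
      - α * (((P n).eval y) ^ 2 * ((1 - y) ^ (α - 1) * (1 + y) ^ β))
      + β * (((P n).eval y) ^ 2 * ((1 - y) ^ α * (1 + y) ^ (β - 1))))
    (by norm_num) ((cP.pow 2).mul (cα.mul cβ)).continuousOn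
    (by
      intro y hy
      have p1 : (1 - y) ≠ 0 := by linarith [hy.2]
      have p2 : (1 + y) ≠ 0 := by linarith [hy.1]
      have d1 := ((hasDerivAt_id y).const_sub 1).rpow_const (p := α) (Or.inl p1)
      have d2 := ((hasDerivAt_id y).const_add 1).rpow_const (p := β) (Or.inl p2)
      have d3 := (((P n).hasDerivAt y).pow 2).mul (d1.mul d2)
      refine d3.congr_deriv ?_
      simp
      ring)
    (((jw.const_mul 2).sub (jα.const_mul α)).add (jβ.const_mul β))
  rw [intervalIntegral.integral_add ((jw.const_mul 2).sub (jα.const_mul α)) (jβ.const_mul β),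
    intervalIntegral.integral_sub (jw.const_mul 2) (jα.const_mul α),
    intervalIntegral.integral_const_mul, intervalIntegral.integral_const_mul,
    intervalIntegral.integral_const_mul, hort] at hftc
  norm_num [Real.zero_rpow hα.ne', Real.zero_rpow hβ.ne'] at hftc
  set I := ∫ y in (-1 : ℝ)..1, ((P n).eval y) ^ 2 * ((1 - y) ^ (α - 1) * (1 + y) ^ β)
  set J := ∫ y in (-1 : ℝ)..1, ((P n).eval y) ^ 2 * ((1 - y) ^ α * (1 + y) ^ (β - 1))
  have key : α * I = β * J := by linarith
  refine ⟨by rw [div_mul_eq_mul_div, div_mul_eq_mul_div, key], ?_⟩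
  intro z hz1 hz2
  have e1 : α / (h n * (1 - z)) * I = -(β / h n * J) / (z - 1) := by
    rw [div_mul_eq_mul_div, key, div_mul_eq_mul_div, ← neg_sub z 1, mul_neg, div_neg, neg_div,
      div_div]
  have e2 : β / (h n * (1 + z)) * J = (β / h n * J) / (z + 1) := by
    rw [div_mul_eq_mul_div, div_mul_eq_mul_div, add_comm 1 z, div_div]
  rw [e1, e2]
end

section
/- For every n ≥ 1, (α/h_{n−1}) ∫_{-1}^1 Pₙ(y) P_{n−1}(y) (1−y)^{α−1} (1+y)^{β} dy = n + rₙ, where rₙ := (β/h_{n−1}) ∫_{-1}^1 Pₙ(y) P_{n−1}(y) (1−y)^{α} (1+y)^{β−1} dy. Consequently the rational function Bₙ(z) = (α/h_{n−1}(1−z)) ∫_{-1}^1 PₙP_{n−1}(1−y)^{α−1}(1+y)^{β} dy + (β/h_{n−1}(1+z)) ∫_{-1}^1 PₙP_{n−1}(1−y)^{α}(1+y)^{β−1} dy equals −(n+rₙ)/(z−1) + rₙ/(z+1) for z ∉ {−1,1}. -/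
open MeasureTheory Polynomial

/-- The Jacobi weight is continuous. -/
lemma jac_w_cont (α β : ℝ) (hα : 0 < α) (hβ : 0 < β) :
    Continuous (fun x : ℝ => (1 - x) ^ α * (1 + x) ^ β) := by
  apply Continuous.mul
  · exact (Real.continuous_rpow_const hα.le).comp (by fun_prop : Continuous fun x : ℝ => 1 - x)
  · exact (Real.continuous_rpow_const hβ.le).comp (by fun_prop : Continuous fun x : ℝ => 1 + x)

lemma jac_int (α β : ℝ) (hα : 0 < α) (hβ : 0 < β) (q r : ℝ[X]) :
    IntervalIntegrable (fun x : ℝ => q.eval x * r.eval x * ((1 - x) ^ α * (1 + x) ^ β))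
      volume (-1) 1 :=
  ((q.continuous.mul r.continuous).mul (jac_w_cont α β hα hβ)).intervalIntegrable _ _

lemma jac_int1 (α β : ℝ) (hα : 0 < α) (hβ : 0 < β) (q r : ℝ[X]) :
    IntervalIntegrable (fun x : ℝ => q.eval x * r.eval x * ((1 - x) ^ (α - 1) * (1 + x) ^ β))
      volume (-1) 1 := by
  have h1 : IntervalIntegrable (fun x : ℝ => (1 - x) ^ (α - 1)) volume (-1) 1 := by
    have := (intervalIntegral.intervalIntegrable_rpow' (a := 2) (b := 0)
      (r := α - 1) (by linarith)).comp_sub_left 1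
    norm_num at this
    exact this
  have hc : Continuous (fun x : ℝ => q.eval x * r.eval x * (1 + x) ^ β) :=
    (q.continuous.mul r.continuous).mul
      ((Real.continuous_rpow_const hβ.le).comp (by fun_prop : Continuous fun x : ℝ => 1 + x))
  refine (h1.continuousOn_mul hc.continuousOn).congr ?_
  intro x _
  simp only
  ring

lemma jac_int2 (α β : ℝ) (hα : 0 < α) (hβ : 0 < β) (q r : ℝ[X]) :
    IntervalIntegrable (fun x : ℝ => q.eval x * r.eval x * ((1 - x) ^ α * (1 + x) ^ (β - 1)))
      volume (-1) 1 := by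
  have h1 : IntervalIntegrable (fun x : ℝ => (1 + x) ^ (β - 1)) volume (-1) 1 := by
    have := (intervalIntegral.intervalIntegrable_rpow' (a := 0) (b := 2)
      (r := β - 1) (by linarith)).comp_add_left 1
    norm_num at this
    exact this
  have hc : Continuous (fun x : ℝ => q.eval x * r.eval x * (1 - x) ^ α) :=
    (q.continuous.mul r.continuous).mul
      ((Real.continuous_rpow_const hα.le).comp (by fun_prop : Continuous fun x : ℝ => 1 - x))
  refine (h1.continuousOn_mul hc.continuousOn).congr ?_
  intro x _
  simp only
  ring

lemma jac_orth (α β : ℝ) (hα : 0 < α) (hβ : 0 < β)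
    (P : ℕ → Polynomial ℝ)
    (hmonic : ∀ n, (P n).Monic) (hdeg : ∀ n, (P n).natDegree = n)
    (horth : ∀ m n : ℕ, m ≠ n →
      ∫ x in (-1 : ℝ)..1, (P m).eval x * (P n).eval x * ((1 - x) ^ α * (1 + x) ^ β) = 0)
    (n : ℕ) : ∀ d ≤ n, ∀ q : ℝ[X], (∀ m, d ≤ m → q.coeff m = 0) →
      ∫ x in (-1 : ℝ)..1, q.eval x * (P n).eval x * ((1 - x) ^ α * (1 + x) ^ β) = 0 := by
  intro d
  induction d with
  | zero =>
    intro _ q hq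
    have : q = 0 := by ext m; simpa using hq m (Nat.zero_le _)
    simp [this]
  | succ d ih =>
    intro hd q hq
    have hz := ih (by omega) (q - C (q.coeff d) * P d) (by
      intro m hm
      rcases hm.eq_or_lt with rfl | hm
      · have : (P d).coeff d = 1 := by
          have := (hmonic d).coeff_natDegree
          rwa [hdeg] at this
        simp [this]
      · have : (P d).coeff m = 0 := coeff_eq_zero_of_natDegree_lt (by rw [hdeg]; exact hm)
        simp [this, hq m hm])
    have e : ∀ x : ℝ, q.eval x * (P n).eval x * ((1 - x) ^ α * (1 + x) ^ β) =
        (q - C (q.coeff d) * P d).eval x * (P n).eval x * ((1 - x) ^ α * (1 + x) ^ β) +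
        q.coeff d * ((P d).eval x * (P n).eval x * ((1 - x) ^ α * (1 + x) ^ β)) := by
      intro x
      simp only [eval_sub, eval_mul, eval_C]
      ring
    simp_rw [e]
    rw [intervalIntegral.integral_add (jac_int α β hα hβ _ _)
      ((jac_int α β hα hβ _ _).const_mul _), hz, intervalIntegral.integral_const_mul,
      horth d n (by omega)]
    simp

lemma jac_pos (α β : ℝ) (hα : 0 < α) (hβ : 0 < β) (q : ℝ[X]) (hq : q ≠ 0) :
    0 < ∫ x in (-1 : ℝ)..1, (q.eval x) ^ 2 * ((1 - x) ^ α * (1 + x) ^ β) := by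
  apply intervalIntegral.integral_pos (by norm_num)
  · exact ((q.continuous.pow 2).mul (jac_w_cont α β hα hβ)).continuousOn
  · intro x hx
    have h1 : 0 ≤ 1 - x := by linarith [hx.2]
    have h2 : 0 ≤ 1 + x := by linarith [hx.1]
    positivity
  · by_contra hcon
    apply hq
    apply eq_zero_of_infinite_isRoot
    apply (Set.Ioo_infinite (by norm_num : (-1 : ℝ) < 1)).mono
    intro x hx
    by_contra hne
    have hne' : q.eval x ≠ 0 := hne
    apply hcon
    refine ⟨x, ⟨hx.1.le, hx.2.le⟩, ?_⟩
    have h1 : 0 < 1 - x := by linarith [hx.2]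
    have h2 : 0 < 1 + x := by linarith [hx.1]
    positivity

lemma jac_parts (α β : ℝ) (hα : 0 < α) (hβ : 0 < β) (q r : ℝ[X]) :
    (∫ x in (-1 : ℝ)..1, (derivative q).eval x * r.eval x * ((1 - x) ^ α * (1 + x) ^ β))
    + (∫ x in (-1 : ℝ)..1, (derivative r).eval x * q.eval x * ((1 - x) ^ α * (1 + x) ^ β))
    - α * (∫ x in (-1 : ℝ)..1, q.eval x * r.eval x * ((1 - x) ^ (α - 1) * (1 + x) ^ β))
    + β * (∫ x in (-1 : ℝ)..1, q.eval x * r.eval x * ((1 - x) ^ α * (1 + x) ^ (β - 1))) = 0 := by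
  have i1 := jac_int α β hα hβ (derivative q) r
  have i2 := jac_int α β hα hβ (derivative r) q
  have i3 := (jac_int1 α β hα hβ q r).const_mul α
  have i4 := (jac_int2 α β hα hβ q r).const_mul β
  rw [← intervalIntegral.integral_const_mul, ← intervalIntegral.integral_const_mul,
    ← intervalIntegral.integral_add i1 i2, ← intervalIntegral.integral_sub (i1.add i2) i3,
    ← intervalIntegral.integral_add ((i1.add i2).sub i3) i4]
  rw [intervalIntegral.integral_eq_sub_of_hasDerivAt_of_le (by norm_num)
    (f := fun x : ℝ => q.eval x * r.eval x * ((1 - x) ^ α * (1 + x) ^ β)) ?_ ?_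
    (((i1.add i2).sub i3).add i4)]
  · simp [Real.zero_rpow hα.ne', Real.zero_rpow hβ.ne']
  · exact ((q.continuous.mul r.continuous).mul (jac_w_cont α β hα hβ)).continuousOn
  · intro x hx
    have h1 : 0 < 1 - x := by linarith [hx.2]
    have h2 : 0 < 1 + x := by linarith [hx.1]
    have d1 : HasDerivAt (fun x : ℝ => (1 - x) ^ α) (-1 * α * (1 - x) ^ (α - 1)) x :=
      ((hasDerivAt_id x).const_sub 1).rpow_const (Or.inl h1.ne')
    have d2 : HasDerivAt (fun x : ℝ => (1 + x) ^ β) (1 * β * (1 + x) ^ (β - 1)) x :=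
      ((hasDerivAt_id x).const_add 1).rpow_const (Or.inl h2.ne')
    refine HasDerivAt.congr_deriv
      (((q.hasDerivAt x).mul (r.hasDerivAt x)).mul (d1.mul d2)) ?_
    simp only [Pi.mul_apply]
    ring

/-- For the Jacobi weight on `[-1,1]` with `α, β > 0` and monic
orthogonal polynomials `Pₙ`, for every `n ≥ 1` we have
`(α/h_{n-1}) ∫ Pₙ P_{n-1} (1-y)^(α-1)(1+y)^β dy = n + rₙ`, where
`rₙ := (β/h_{n-1}) ∫ Pₙ P_{n-1} (1-y)^α (1+y)^(β-1) dy`; consequently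
`Bₙ(z) = (α/h_{n-1}(1-z)) ∫ PₙP_{n-1}(1-y)^(α-1)(1+y)^β + (β/h_{n-1}(1+z)) ∫ PₙP_{n-1}(1-y)^α(1+y)^(β-1)`
equals `-(n+rₙ)/(z-1) + rₙ/(z+1)` for `z ∉ {-1,1}`. -/
theorem jacobi_Bn_eval
    (α β : ℝ) (hα : 0 < α) (hβ : 0 < β)
    (P : ℕ → Polynomial ℝ)
    (hmonic : ∀ n, (P n).Monic) (hdeg : ∀ n, (P n).natDegree = n)
    (horth : ∀ m n : ℕ, m ≠ n →
      ∫ x in (-1 : ℝ)..1, (P m).eval x * (P n).eval x * ((1 - x) ^ α * (1 + x) ^ β) = 0)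
    (h : ℕ → ℝ)
    (hh : ∀ n, h n = ∫ x in (-1 : ℝ)..1, ((P n).eval x) ^ 2 * ((1 - x) ^ α * (1 + x) ^ β)) :
    ∀ n : ℕ, 1 ≤ n →
      (α / h (n - 1)) *
          (∫ y in (-1 : ℝ)..1,
            (P n).eval y * (P (n - 1)).eval y * ((1 - y) ^ (α - 1) * (1 + y) ^ β))
        = (n : ℝ) + (β / h (n - 1)) *
            (∫ y in (-1 : ℝ)..1,
              (P n).eval y * (P (n - 1)).eval y * ((1 - y) ^ α * (1 + y) ^ (β - 1)))
      ∧ ∀ z : ℝ, z ≠ 1 → z ≠ -1 →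
          (α / (h (n - 1) * (1 - z))) *
              (∫ y in (-1 : ℝ)..1,
                (P n).eval y * (P (n - 1)).eval y * ((1 - y) ^ (α - 1) * (1 + y) ^ β))
            + (β / (h (n - 1) * (1 + z))) *
              (∫ y in (-1 : ℝ)..1,
                (P n).eval y * (P (n - 1)).eval y * ((1 - y) ^ α * (1 + y) ^ (β - 1)))
          = -(((n : ℝ) + (β / h (n - 1)) *
                (∫ y in (-1 : ℝ)..1,
                  (P n).eval y * (P (n - 1)).eval y * ((1 - y) ^ α * (1 + y) ^ (β - 1)))))
              / (z - 1)
            + ((β / h (n - 1)) *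
                (∫ y in (-1 : ℝ)..1,
                  (P n).eval y * (P (n - 1)).eval y * ((1 - y) ^ α * (1 + y) ^ (β - 1))))
              / (z + 1) := by
  intro n hn
  obtain ⟨k, rfl⟩ : ∃ k, n = k + 1 := ⟨n - 1, by omega⟩
  simp only [Nat.add_sub_cancel]
  have hpos : 0 < h k := by
    rw [hh]; exact jac_pos α β hα hβ _ (hmonic k).ne_zero
  have key := jac_parts α β hα hβ (P (k + 1)) (P k)
  have z2 : ∫ x in (-1 : ℝ)..1, (derivative (P k)).eval x * (P (k + 1)).eval x *
      ((1 - x) ^ α * (1 + x) ^ β) = 0 := by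
    apply jac_orth α β hα hβ P hmonic hdeg horth (k + 1) (k + 1) le_rfl
    intro m hm
    rw [coeff_derivative, coeff_eq_zero_of_natDegree_lt (by rw [hdeg]; omega), zero_mul]
  have z3 : ∫ x in (-1 : ℝ)..1, (derivative (P (k + 1)) - C ((k : ℝ) + 1) * P k).eval x *
      (P k).eval x * ((1 - x) ^ α * (1 + x) ^ β) = 0 := by
    apply jac_orth α β hα hβ P hmonic hdeg horth k k le_rfl
    intro m hm
    rw [coeff_sub, coeff_derivative, coeff_C_mul]
    rcases hm.eq_or_lt with rfl | hm
    · have e1 := (hmonic k).coeff_natDegree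
      have e2 := (hmonic (k + 1)).coeff_natDegree
      rw [hdeg] at e1 e2
      rw [e1, e2]; ring
    · rw [coeff_eq_zero_of_natDegree_lt (by rw [hdeg]; omega),
        coeff_eq_zero_of_natDegree_lt (by rw [hdeg]; omega)]
      ring
  have z1 : ∫ x in (-1 : ℝ)..1, (derivative (P (k + 1))).eval x * (P k).eval x *
      ((1 - x) ^ α * (1 + x) ^ β) = ((k : ℝ) + 1) * h k := by
    have e : ∀ x : ℝ, (derivative (P (k + 1))).eval x * (P k).eval x *
        ((1 - x) ^ α * (1 + x) ^ β) =
        (derivative (P (k + 1)) - C ((k : ℝ) + 1) * P k).eval x *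
          (P k).eval x * ((1 - x) ^ α * (1 + x) ^ β) +
        ((k : ℝ) + 1) * ((P k).eval x * (P k).eval x * ((1 - x) ^ α * (1 + x) ^ β)) := by
      intro x
      simp only [eval_sub, eval_mul, eval_C]
      ring
    simp_rw [e]
    rw [intervalIntegral.integral_add (jac_int α β hα hβ _ _)
      ((jac_int α β hα hβ _ _).const_mul _), z3, intervalIntegral.integral_const_mul, hh, zero_add]
    simp_rw [sq]
  rw [z1, z2] at key
  generalize (∫ y in (-1 : ℝ)..1,
    (P (k + 1)).eval y * (P k).eval y * ((1 - y) ^ (α - 1) * (1 + y) ^ β)) = I at key ⊢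
  generalize (∫ y in (-1 : ℝ)..1,
    (P (k + 1)).eval y * (P k).eval y * ((1 - y) ^ α * (1 + y) ^ (β - 1))) = J at key ⊢
  have main : α / h k * I = ((k + 1 : ℕ) : ℝ) + β / h k * J := by
    push_cast
    field_simp
    linarith
  refine ⟨main, ?_⟩
  intro z hz1 hz2
  rw [← main]
  have a1 : z - 1 ≠ 0 := sub_ne_zero.mpr hz1
  have a2 : 1 - z ≠ 0 := sub_ne_zero.mpr hz1.symm
  have a3 : z + 1 ≠ 0 := fun hc => hz2 (by linarith)
  have e1 : 1 - z = -(z - 1) := by ring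
  have e2 : 1 + z = z + 1 := by ring
  rw [e1, e2]
  field_simp
end

section
/- (Residues of the first supplementary condition S₁ at z = 1 and z = −1.) For every n ≥ 1: −2n − 1 − rₙ − r_{n+1} = α − Rₙ(1 − aₙ), and rₙ + r_{n+1} = β − Rₙ(1 + aₙ). -/
open MeasureTheory Polynomial

/-- Integration of a polynomial against an integrable weight, as a linear map. -/
noncomputable def wInt (u : ℝ → ℝ) (hu : IntervalIntegrable u volume (-1) 1) :
    Polynomial ℝ →ₗ[ℝ] ℝ where
  toFun q := ∫ x in (-1 : ℝ)..1, q.eval x * u x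
  map_add' p q := by
    have hp := hu.continuousOn_mul (g := fun x => p.eval x) p.continuous.continuousOn
    have hq := hu.continuousOn_mul (g := fun x => q.eval x) q.continuous.continuousOn
    rw [← intervalIntegral.integral_add hp hq]
    congr 1; ext x; simp [add_mul]
  map_smul' c q := by
    simp only [eval_smul, smul_eq_mul, RingHom.id_apply, mul_assoc]
    rw [intervalIntegral.integral_const_mul]

lemma weight_int (α β : ℝ) (hα : 0 < α) (hβ : 0 < β) :
    IntervalIntegrable (fun x : ℝ => (1 - x) ^ α * (1 + x) ^ (β - 1)) volume (-1) 1 := by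
  have h1 : IntervalIntegrable (fun x : ℝ => x ^ (β - 1)) volume 0 2 :=
    intervalIntegral.intervalIntegrable_rpow' (by linarith)
  have h2 := h1.comp_add_left 1
  norm_num at h2
  refine h2.continuousOn_mul ?_
  exact (Continuous.rpow_const (by fun_prop) (fun x => Or.inr hα.le)).continuousOn

lemma weight_eq (α β : ℝ) (hβ : 0 < β) (x : ℝ) :
    (1 - x) ^ α * (1 + x) ^ β = (1 + x) * ((1 - x) ^ α * (1 + x) ^ (β - 1)) := by
  by_cases hx : 1 + x = 0
  · rw [hx, Real.zero_rpow hβ.ne']; simp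
  · rw [Real.rpow_sub_one hx]; field_simp

lemma weight_pos (α β : ℝ) (hα : 0 < α) (hβ : 0 < β) (p : Polynomial ℝ) (hp : p ≠ 0) :
    0 < ∫ x in (-1 : ℝ)..1, (p.eval x) ^ 2 * ((1 - x) ^ α * (1 + x) ^ β) := by
  apply intervalIntegral.integral_pos (by norm_num)
  · refine Continuous.continuousOn ?_
    refine (p.continuous.pow 2).mul (Continuous.mul ?_ ?_)
    · exact Continuous.rpow_const (by fun_prop) (fun x => Or.inr hα.le)
    · exact Continuous.rpow_const (by fun_prop) (fun x => Or.inr hβ.le)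
  · intro x hx
    have h1 : 0 ≤ 1 - x := by linarith [hx.2]
    have h2 : 0 ≤ 1 + x := by linarith [hx.1]
    positivity
  · have hinf : (Set.Ioo (-1 : ℝ) 1).Infinite := Set.Ioo_infinite (by norm_num)
    obtain ⟨c, hc, hc'⟩ := hinf.exists_notMem_finset p.roots.toFinset
    have h0 : p.eval c ≠ 0 := by
      intro h; apply hc'; simp [hp, h]
    refine ⟨c, ⟨hc.1.le, hc.2.le⟩, ?_⟩
    have h1 : 0 < 1 - c := by linarith [hc.2]
    have h2 : 0 < 1 + c := by linarith [hc.1]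
    positivity

lemma parts (α β : ℝ) (hα : 0 < α) (hβ : 0 < β) (q : Polynomial ℝ) :
    ∫ x in (-1 : ℝ)..1, ((derivative q * (1 - X) * (1 + X) - C (α + 1) * q * (1 + X)
      + C β * q * (1 - X)).eval x) * ((1 - x) ^ α * (1 + x) ^ (β - 1)) = 0 := by
  have hint := (weight_int α β hα hβ).continuousOn_mul
    (g := fun x => (derivative q * (1 - X) * (1 + X) - C (α + 1) * q * (1 + X)
      + C β * q * (1 - X)).eval x) (Polynomial.continuous _).continuousOn
  have hcont : ContinuousOn (fun x : ℝ => q.eval x * ((1 - x) ^ (α + 1) * (1 + x) ^ β))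
      (Set.Icc (-1) 1) := by
    refine Continuous.continuousOn ?_
    refine q.continuous.mul (Continuous.mul ?_ ?_)
    · exact Continuous.rpow_const (by fun_prop) (fun x => Or.inr (by linarith))
    · exact Continuous.rpow_const (by fun_prop) (fun x => Or.inr hβ.le)
  rw [intervalIntegral.integral_eq_sub_of_hasDerivAt_of_le (by norm_num) hcont _ hint]
  · have : α + 1 ≠ 0 := by linarith
    simp [Real.zero_rpow this, Real.zero_rpow hβ.ne']
  · intro x hx
    have h1 : 0 < 1 - x := by linarith [hx.2]
    have h2 : 0 < 1 + x := by linarith [hx.1]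
    have d1 : HasDerivAt (fun x : ℝ => (1 - x) ^ (α + 1)) _ x :=
      ((hasDerivAt_id x).const_sub 1).rpow_const (p := α + 1) (Or.inl h1.ne')
    have d2 : HasDerivAt (fun x : ℝ => (1 + x) ^ β) _ x :=
      ((hasDerivAt_id x).const_add 1).rpow_const (p := β) (Or.inl h2.ne')
    refine ((q.hasDerivAt x).mul (d1.mul d2)).congr_deriv ?_
    have e1 : (1 - x) ^ (α + 1) = (1 - x) ^ α * (1 - x) := Real.rpow_add_one h1.ne' α
    have e2 : (1 + x) ^ β = (1 + x) ^ (β - 1) * (1 + x) := by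
      rw [← Real.rpow_add_one h2.ne']; ring_nf
    simp only [Pi.mul_apply, id, add_sub_cancel_right, e1, e2, eval_add, eval_sub, eval_mul, eval_one, eval_X, eval_C]
    ring

lemma orth_lower (P : ℕ → Polynomial ℝ) (I : Polynomial ℝ →ₗ[ℝ] ℝ)
    (hmonic : ∀ n, (P n).Monic) (hdeg : ∀ n, (P n).natDegree = n)
    (horth : ∀ m n : ℕ, m ≠ n → I (P m * P n) = 0) (n : ℕ) :
    ∀ k ≤ n, ∀ q : Polynomial ℝ, q.degree < (k : WithBot ℕ) → I (q * P n) = 0 := by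
  intro k
  induction k with
  | zero =>
    intro _ q hq
    have : q = 0 := by
      ext i
      rw [Polynomial.degree_lt_iff_coeff_zero] at hq
      simpa using hq i (by omega)
    simp [this]
  | succ k ih =>
    intro hk q hq
    have hq' := ih (by omega) (q - C (q.coeff k) * P k) (by
      rw [Polynomial.degree_lt_iff_coeff_zero] at hq ⊢
      intro m hm
      rw [coeff_sub, coeff_C_mul]
      rcases hm.eq_or_lt with rfl | hlt
      · have := hmonic k
        rw [Monic, leadingCoeff, hdeg] at this
        rw [this]; ring
      · rw [hq m hlt, coeff_eq_zero_of_natDegree_lt (p := P k) (by rw [hdeg]; exact hlt)]; ring)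
    rw [sub_mul, map_sub, mul_assoc, ← smul_eq_C_mul, map_smul, horth k n (by omega)] at hq'
    simpa using hq'

/-- Residues of the supplementary condition S₁ at `z = 1` and `z = -1`:
for every `n ≥ 1`, `-2n - 1 - rₙ - r_{n+1} = α - Rₙ(1 - aₙ)` and
`rₙ + r_{n+1} = β - Rₙ(1 + aₙ)`. -/
theorem jacobi_S1_residues
    (α β : ℝ) (hα : 0 < α) (hβ : 0 < β)
    (P : ℕ → Polynomial ℝ)
    (hmonic : ∀ n, (P n).Monic) (hdeg : ∀ n, (P n).natDegree = n)
    (horth : ∀ m n : ℕ, m ≠ n →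
      ∫ x in (-1 : ℝ)..1, (P m).eval x * (P n).eval x * ((1 - x) ^ α * (1 + x) ^ β) = 0)
    (h : ℕ → ℝ)
    (hh : ∀ n, h n = ∫ x in (-1 : ℝ)..1, ((P n).eval x) ^ 2 * ((1 - x) ^ α * (1 + x) ^ β))
    (a b : ℕ → ℝ)
    (hrec : ∀ n : ℕ, 1 ≤ n → ∀ x : ℝ,
      x * (P n).eval x = (P (n + 1)).eval x + a n * (P n).eval x + b n * (P (n - 1)).eval x)
    (R r : ℕ → ℝ)
    (hR : ∀ n : ℕ, 1 ≤ n → R n =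
      (β / h n) * ∫ y in (-1 : ℝ)..1, ((P n).eval y) ^ 2 * ((1 - y) ^ α * (1 + y) ^ (β - 1)))
    (hr : ∀ n : ℕ, 1 ≤ n → r n =
      (β / h (n - 1)) * ∫ y in (-1 : ℝ)..1,
        (P n).eval y * (P (n - 1)).eval y * ((1 - y) ^ α * (1 + y) ^ (β - 1))) :
    ∀ n : ℕ, 1 ≤ n →
      (-(2 * (n : ℝ)) - 1 - r n - r (n + 1) = α - R n * (1 - a n))
      ∧ (r n + r (n + 1) = β - R n * (1 + a n)) := by
  intro n hn
  set J := wInt _ (weight_int α β hα hβ) with hJ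
  have Jdef : ∀ q : Polynomial ℝ, J q =
    ∫ x in (-1 : ℝ)..1, q.eval x * ((1 - x) ^ α * (1 + x) ^ (β - 1)) := fun q => rfl
  set I : Polynomial ℝ →ₗ[ℝ] ℝ := J ∘ₗ LinearMap.mulLeft ℝ (1 + X) with hI
  have IJ : ∀ q, I q = J ((1 + X) * q) := fun q => rfl
  have Idef : ∀ q : Polynomial ℝ, I q =
      ∫ x in (-1 : ℝ)..1, q.eval x * ((1 - x) ^ α * (1 + x) ^ β) := by
    intro q
    rw [IJ, Jdef]
    congr 1; ext x
    rw [weight_eq α β hβ x]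
    simp only [eval_add, eval_mul, eval_one, eval_X]
    ring
  have hI2 : ∀ n, h n = I (P n * P n) := by
    intro n; rw [hh, Idef]; simp [sq]
  have hpos : ∀ n, 0 < h n := by
    intro n; rw [hh]; exact weight_pos α β hα hβ _ (hmonic n).ne_zero
  have horth' : ∀ m n : ℕ, m ≠ n → I (P m * P n) = 0 := by
    intro m n hmn; rw [Idef]; simpa using horth m n hmn
  have low := orth_lower P I hmonic hdeg horth'
  have hRJ : R n = β / h n * J (P n * P n) := by
    rw [hR n hn, Jdef]; simp [sq]
  have hrJ : ∀ n, 1 ≤ n → r n = β / h (n - 1) * J (P n * P (n - 1)) := by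
    intro n hn; rw [hr n hn, Jdef]; simp
  have hrn := hrJ n hn
  have hrn1 := hrJ (n + 1) (by omega)
  rw [Nat.add_sub_cancel] at hrn1
  have hpoly : X * P n = P (n + 1) + C (a n) * P n + C (b n) * P (n - 1) := by
    apply Polynomial.funext; intro x
    simpa using hrec n hn x
  have hcn : ∀ k, (P k).coeff k = 1 := by
    intro k
    have := hmonic k
    rwa [Monic, leadingCoeff, hdeg] at this
  have hz : ∀ k m, k < m → (P k).coeff m = 0 := fun k m hkm =>
    coeff_eq_zero_of_natDegree_lt (by rw [hdeg]; exact hkm)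
  -- `h n = b n * h (n-1)`
  have hb : h n = b n * h (n - 1) := by
    have h1 := low n n le_rfl (X * P (n - 1) - P n) (by
      rw [Polynomial.degree_lt_iff_coeff_zero]
      intro m hm
      obtain ⟨k, rfl⟩ : ∃ k, m = k + 1 := ⟨m - 1, by omega⟩
      rw [coeff_sub, coeff_X_mul]
      rcases hm.eq_or_lt with rfl | hlt
      · simp [hcn]
      · rw [hz _ _ (by omega), hz _ _ hlt]; ring)
    have h2 : (X * P (n - 1) - P n) * P n =
        P (n + 1) * P (n - 1) + a n • (P n * P (n - 1)) + b n • (P (n - 1) * P (n - 1))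
          - P n * P n := by
      simp only [smul_eq_C_mul]
      linear_combination P (n - 1) * hpoly
    rw [h2] at h1
    simp only [map_add, map_sub, map_smul, smul_eq_mul] at h1
    rw [horth' (n + 1) (n - 1) (by omega), horth' n (n - 1) (by omega), ← hI2, ← hI2] at h1
    linarith
  have hS : (1 + a n) * J (P n * P n) = h n - J (P (n + 1) * P n) - b n * J (P n * P (n - 1)) := by
    have h2 : (1 + a n) • (P n * P n) =
        (1 + X) * (P n * P n) - P (n + 1) * P n - b n • (P n * P (n - 1)) := by
      simp only [smul_eq_C_mul, C_add, C_1]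
      linear_combination - P n * hpoly
    have h3 := congrArg J h2
    simp only [map_sub, map_smul, smul_eq_mul] at h3
    rw [h3, ← IJ, ← hI2]
  have hsec : r n + r (n + 1) = β - R n * (1 + a n) := by
    have p1 := (hpos n).ne'
    have p2 := (hpos (n - 1)).ne'
    have e : r n = β / h n * (b n * J (P n * P (n - 1))) := by
      rw [hrn]
      have hbn : b n ≠ 0 := by rintro h0; rw [h0] at hb; simp at hb; exact p1 hb
      rw [hb]; field_simp
    rw [e, hrn1, hRJ]
    have e2 : β = β / h n * h n := by field_simp
    linear_combination (β / h n) * hS - e2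
  have hsum : 2 * R n = 2 * n + 1 + α + β := by
    have h1 := parts α β hα hβ (P n * P n)
    rw [← Jdef] at h1
    have h2 : derivative (P n * P n) * (1 - X) * (1 + X) - C (α + 1) * (P n * P n) * (1 + X)
        + C β * (P n * P n) * (1 - X) =
        (1 + X) * ((2 : ℝ) • ((derivative (P n) * (1 - X) + C (n : ℝ) * P n) * P n)
          - (2 * (n : ℝ) + α + 1 + β) • (P n * P n)) + (2 * β) • (P n * P n) := by
      simp only [smul_eq_C_mul, derivative_mul, C_add, C_mul, C_1]
      have : (C (2 : ℝ)) = (2 : Polynomial ℝ) := rfl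
      rw [this]
      ring
    rw [h2, map_add, ← IJ, map_sub, map_smul, map_smul, map_smul, ← hI2,
      low n n le_rfl _ (by
        rw [Polynomial.degree_lt_iff_coeff_zero]
        intro m hm
        obtain ⟨k, rfl⟩ : ∃ k, m = k + 1 := ⟨m - 1, by omega⟩
        rw [mul_sub, mul_one, coeff_add, coeff_sub, coeff_C_mul, coeff_mul_X,
          coeff_derivative, coeff_derivative]
        rcases hm.eq_or_lt with rfl | hlt
        · rw [hz _ _ (by omega), hcn]; push_cast; ring
        · rw [hz _ _ (by omega), hz _ _ hlt]; ring)] at h1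
    simp only [smul_eq_mul] at h1
    rw [hRJ]
    have p1 := (hpos n).ne'
    field_simp
    linarith
  refine ⟨?_, hsec⟩
  linear_combination -hsec + hsum
end

section
/- (Residues of the second supplementary condition S₂ at z = 1 and z = −1.) For every n ≥ 1: (rₙ − r_{n+1} − 1)(1 − aₙ) = bₙ R_{n−1} − b_{n+1} R_{n+1}, and (rₙ − r_{n+1})(1 + aₙ) = b_{n+1} R_{n+1} − bₙ R_{n−1}. -/
open MeasureTheory Polynomial

namespace JacobiAux

lemma low (L : ℝ[X] →ₗ[ℝ] ℝ) (P : ℕ → ℝ[X])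
    (hmonic : ∀ n, (P n).Monic) (hdeg : ∀ n, (P n).natDegree = n)
    (horth : ∀ m n : ℕ, m ≠ n → L (P m * P n) = 0) (n : ℕ) :
    ∀ d : ℕ, d ≤ n → ∀ q : ℝ[X], (∀ m, d ≤ m → q.coeff m = 0) → L (q * P n) = 0 := by
  intro d
  induction d with
  | zero =>
    intro _ q hq
    have : q = 0 := by ext m; simpa using hq m (Nat.zero_le m)
    simp [this]
  | succ d ih =>
    intro hd q hq
    have h1 : L ((q - C (q.coeff d) * P d) * P n) = 0 := by
      apply ih (by omega)
      intro m hm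
      rcases Nat.eq_or_lt_of_le hm with rfl | hm'
      · have : (P d).coeff d = 1 := by
          have := (hmonic d).coeff_natDegree
          rwa [hdeg] at this
        simp [this]
      · have : (P d).coeff m = 0 := coeff_eq_zero_of_natDegree_lt (by rw [hdeg]; exact hm')
        simp [this, hq m hm']
    have h2 : (q - C (q.coeff d) * P d) * P n = q * P n - q.coeff d • (P d * P n) := by
      rw [smul_eq_C_mul]; ring
    rw [h2, map_sub, map_smul, horth d n (by omega)] at h1
    simpa using h1

lemma rr (α β : ℝ) (L M : ℝ[X] →ₗ[ℝ] ℝ) (P : ℕ → ℝ[X])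
    (hmonic : ∀ n, (P n).Monic) (hdeg : ∀ n, (P n).natDegree = n)
    (horth : ∀ m n : ℕ, m ≠ n → L (P m * P n) = 0)
    (hibp : ∀ q, 2 * M q = (1 + α + β) * L q - L ((1 - X) * derivative q)) (k : ℕ) :
    2 * M (P (k + 1) * P k) = -((k : ℝ) + 1 + (P (k + 1)).coeff k) * L (P k * P k) := by
  have hlow := low L P hmonic hdeg horth
  have hc : ∀ n m, n < m → (P n).coeff m = 0 := fun n m hm =>
    coeff_eq_zero_of_natDegree_lt (by rw [hdeg]; exact hm)
  have h1 : ∀ n, (P n).coeff n = 1 := fun d => by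
    have := (hmonic d).coeff_natDegree
    rwa [hdeg] at this
  rw [hibp, horth _ _ (by omega)]
  set s := (P (k + 1)).coeff k with hs
  have e1 : L (((1 - X) * derivative (P k)) * P (k + 1)) = 0 := by
    apply hlow (k + 1) (k + 1) le_rfl
    intro m hm
    obtain ⟨m, rfl⟩ : ∃ j, m = j + 1 := ⟨m - 1, by omega⟩
    rw [sub_mul, one_mul, coeff_sub, coeff_X_mul, coeff_derivative, coeff_derivative,
      hc _ _ (by omega), hc _ _ (by omega)]
    simp
  have e2 : L (((1 - X) * derivative (P (k + 1)) + C ((k : ℝ) + 1) * P (k + 1)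
      - C ((k : ℝ) + 1 + s) * P k) * P k) = 0 := by
    apply hlow k k le_rfl
    intro m hm
    have hX : (X * derivative (P (k + 1))).coeff m = m * (P (k + 1)).coeff m := by
      cases m with
      | zero => simp
      | succ m => rw [coeff_X_mul, coeff_derivative]; push_cast; ring
    rw [sub_mul, one_mul, coeff_sub, coeff_add, coeff_sub, hX, coeff_derivative, coeff_C_mul,
      coeff_C_mul]
    rcases Nat.eq_or_lt_of_le hm with rfl | hm'
    · rw [h1, h1, ← hs]; ring
    · rw [hc _ (m + 1) (by omega), hc k m hm']
      rcases Nat.eq_or_lt_of_le hm' with rfl | hm''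
      · push_cast; ring
      · rw [hc _ _ hm'']; ring
  have e3 : (1 - X) * derivative (P (k + 1) * P k) =
      ((1 - X) * derivative (P (k + 1)) + C ((k : ℝ) + 1) * P (k + 1)
      - C ((k : ℝ) + 1 + s) * P k) * P k + ((1 - X) * derivative (P k)) * P (k + 1)
      - ((k : ℝ) + 1) • (P (k + 1) * P k) + ((k : ℝ) + 1 + s) • (P k * P k) := by
    rw [derivative_mul, smul_eq_C_mul, smul_eq_C_mul]; ring
  rw [e3, map_add, map_sub, map_add, e1, e2, map_smul, map_smul, horth _ _ (by omega)]
  simp only [smul_eq_mul]; ring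

lemma core (α β : ℝ) (L M : ℝ[X] →ₗ[ℝ] ℝ) (P : ℕ → ℝ[X])
    (hmonic : ∀ n, (P n).Monic) (hdeg : ∀ n, (P n).natDegree = n)
    (horth : ∀ m n : ℕ, m ≠ n → L (P m * P n) = 0)
    (hpos : ∀ n, L (P n * P n) ≠ 0)
    (hM : ∀ q, M ((1 + X) * q) = β * L q)
    (hibp : ∀ q, 2 * M q = (1 + α + β) * L q - L ((1 - X) * derivative q))
    (a b : ℕ → ℝ)
    (hrec : ∀ n, X * P (n + 1) = P (n + 2) + a (n + 1) • P (n + 1) + b (n + 1) • P n)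
    (R r : ℕ → ℝ)
    (hR : ∀ n, R n = M (P n * P n) / L (P n * P n))
    (hr : ∀ n, r (n + 1) = M (P (n + 1) * P n) / L (P n * P n)) (m : ℕ) :
    ((r (m + 1) - r (m + 2) - 1) * (1 - a (m + 1)) = b (m + 1) * R m - b (m + 2) * R (m + 2))
      ∧ ((r (m + 1) - r (m + 2)) * (1 + a (m + 1))
        = b (m + 2) * R (m + 2) - b (m + 1) * R m) := by
  have hlow := low L P hmonic hdeg horth
  have hc : ∀ n m, n < m → (P n).coeff m = 0 := fun n m hm =>
    coeff_eq_zero_of_natDegree_lt (by rw [hdeg]; exact hm)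
  have h1 : ∀ n, (P n).coeff n = 1 := fun d => by
    have := (hmonic d).coeff_natDegree
    rwa [hdeg] at this
  have hb : ∀ n, b (n + 1) * L (P n * P n) = L (P (n + 1) * P (n + 1)) := by
    intro n
    have e1 : L ((X * P n - P (n + 1)) * P (n + 1)) = 0 := by
      apply hlow (n + 1) (n + 1) le_rfl
      intro j hj
      obtain ⟨j, rfl⟩ : ∃ i, j = i + 1 := ⟨j - 1, by omega⟩
      rw [coeff_sub, coeff_X_mul]
      rcases Nat.eq_or_lt_of_le hj with hj' | hj'
      · obtain rfl : n = j := by omega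
        rw [h1, h1, sub_self]
      · rw [hc _ _ (by omega), hc _ _ hj', sub_self]
    have e2 : (X * P n - P (n + 1)) * P (n + 1) = P n * P (n + 2)
        + a (n + 1) • (P n * P (n + 1)) + b (n + 1) • (P n * P n) - P (n + 1) * P (n + 1) := by
      have := hrec n
      simp only [smul_eq_C_mul] at this ⊢
      linear_combination P n * this
    rw [e2, map_sub, map_add, map_add, map_smul, map_smul, horth _ _ (by omega),
      horth _ _ (by omega)] at e1
    simp only [smul_eq_mul] at e1
    linarith
  have hs : (P (m + 1)).coeff m = (P (m + 2)).coeff (m + 1) + a (m + 1) := by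
    have := congrArg (fun p => p.coeff (m + 1)) (hrec m)
    simp only [coeff_X_mul, coeff_add, coeff_smul, h1, hc m (m + 1) (by omega), smul_eq_mul] at this
    linarith
  have q1 : M (P (m + 2) * P (m + 2)) + (1 + a (m + 1)) * M (P (m + 2) * P (m + 1))
      + b (m + 1) * M (P (m + 2) * P m) = 0 := by
    have := hM (P (m + 2) * P (m + 1))
    rw [horth _ _ (by omega)] at this
    have e : (1 + X) * (P (m + 2) * P (m + 1)) = P (m + 2) * P (m + 2)
        + (1 + a (m + 1)) • (P (m + 2) * P (m + 1)) + b (m + 1) • (P (m + 2) * P m) := by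
      have := hrec m
      simp only [smul_eq_C_mul, map_add, map_one] at this ⊢
      linear_combination P (m + 2) * this
    rw [e] at this
    simpa using this
  have q2 : M (P (m + 2) * P m) + (1 + a (m + 1)) * M (P (m + 1) * P m)
      + b (m + 1) * M (P m * P m) = 0 := by
    have := hM (P (m + 1) * P m)
    rw [horth _ _ (by omega)] at this
    have e : (1 + X) * (P (m + 1) * P m) = P (m + 2) * P m
        + (1 + a (m + 1)) • (P (m + 1) * P m) + b (m + 1) • (P m * P m) := by
      have := hrec m
      simp only [smul_eq_C_mul, map_add, map_one] at this ⊢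
      linear_combination P m * this
    rw [e] at this
    simpa using this
  have r1 := rr α β L M P hmonic hdeg horth hibp m
  have r2 := rr α β L M P hmonic hdeg horth hibp (m + 1)
  have p0 := hpos m
  have p1 := hpos (m + 1)
  have p2 := hpos (m + 2)
  have b1 := hb m
  have b2 := hb (m + 1)
  have R2 : b (m + 2) * R (m + 2) = M (P (m + 2) * P (m + 2)) / L (P (m + 1) * P (m + 1)) := by
    rw [hR, ← b2]
    have : b (m + 2) ≠ 0 := by
      intro h0
      apply p2
      rw [← b2]
      simp [h0]
    show b (m + 2) * (_ / (b (m + 2) * _)) = _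
    field_simp
  have d : 2 * (r (m + 1) - r (m + 2)) = 1 - a (m + 1) := by
    have x1 : 2 * r (m + 1) = -((m : ℝ) + 1 + (P (m + 1)).coeff m) := by
      rw [hr, ← mul_div_assoc, r1]; field_simp
    have x2 : 2 * r (m + 2) = -((m : ℝ) + 1 + 1 + (P (m + 2)).coeff (m + 1)) := by
      rw [hr, ← mul_div_assoc, r2]; push_cast; field_simp
    rw [hs] at x1
    linarith
  have S : (r (m + 1) - r (m + 2)) * (1 + a (m + 1))
        = b (m + 2) * R (m + 2) - b (m + 1) * R m := by
    have bn : b (m + 1) ≠ 0 := by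
      intro h0
      apply p1
      rw [← b1]
      simp [h0]
    rw [R2, hr, hr, hR, ← b1]
    field_simp
    linear_combination b (m + 1) * q2 - q1
  exact ⟨by linear_combination (-1) * S + d, S⟩

lemma ii (α β : ℝ) (hα : 0 < α) (hβ : 0 < β) (q : ℝ[X]) :
    IntervalIntegrable (fun y : ℝ => q.eval y * ((1 - y) ^ α * (1 + y) ^ (β - 1)))
      volume (-1) 1 := by
  have h0 : IntervalIntegrable (fun y : ℝ => (1 + y) ^ (β - 1)) volume (-1) 1 := by
    have := (intervalIntegral.intervalIntegrable_rpow' (a := 0) (b := 2) (r := β - 1)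
      (by linarith)).comp_add_left 1
    norm_num at this
    exact this
  have hc : Continuous (fun y : ℝ => q.eval y * (1 - y) ^ α) :=
    q.continuous.mul ((continuous_const.sub continuous_id).rpow_const (fun _ => Or.inr hα.le))
  have := h0.continuousOn_mul hc.continuousOn
  refine this.congr ?_
  intro y _
  simp only
  ring

lemma cont (α β : ℝ) (hα : 0 < α) (hβ : 0 < β) (q : ℝ[X]) :
    Continuous (fun y : ℝ => q.eval y * ((1 - y) ^ α * (1 + y) ^ β)) :=
  q.continuous.mul (((continuous_const.sub continuous_id).rpow_const (fun _ => Or.inr hα.le)).mul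
    ((continuous_const.add continuous_id).rpow_const (fun _ => Or.inr hβ.le)))

/-- The functional of integration against a weight. -/
noncomputable def F (w : ℝ → ℝ)
    (hw : ∀ q : ℝ[X], IntervalIntegrable (fun y : ℝ => q.eval y * w y) volume (-1) 1) :
    ℝ[X] →ₗ[ℝ] ℝ where
  toFun q := ∫ y in (-1 : ℝ)..1, q.eval y * w y
  map_add' p q := by
    rw [← intervalIntegral.integral_add (hw p) (hw q)]
    congr 1; ext y; rw [eval_add]; ring
  map_smul' c q := by
    rw [RingHom.id_apply, smul_eq_mul, ← intervalIntegral.integral_const_mul]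
    congr 1; ext y; rw [eval_smul, smul_eq_mul]; ring

lemma ibp (α β : ℝ) (hα : 0 < α) (hβ : 0 < β) (q : ℝ[X]) :
    β * (∫ y in (-1 : ℝ)..1, ((1 - X) * q).eval y * ((1 - y) ^ α * (1 + y) ^ (β - 1))) +
    (∫ y in (-1 : ℝ)..1, ((1 - X) * derivative q - C (α + 1) * q).eval y
      * ((1 - y) ^ α * (1 + y) ^ β)) = 0 := by
  have i1 := ii α β hα hβ ((1 - X) * q)
  have i2 := (cont α β hα hβ ((1 - X) * derivative q - C (α + 1) * q)).intervalIntegrable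
    (μ := volume) (-1) 1
  rw [← intervalIntegral.integral_const_mul, ← intervalIntegral.integral_add (i1.const_mul β) i2]
  have := intervalIntegral.integral_eq_sub_of_hasDerivAt_of_le (a := -1) (b := 1) (by norm_num)
    (f := fun y : ℝ => q.eval y * ((1 - y) ^ (α + 1) * (1 + y) ^ β))
    (cont (α + 1) β (by linarith) hβ q).continuousOn ?_ ((i1.const_mul β).add i2)
  · rw [this]
    have e1 : (0 : ℝ) ^ β = 0 := Real.zero_rpow hβ.ne'
    have e2 : (0 : ℝ) ^ (α + 1) = 0 := Real.zero_rpow (by linarith)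
    norm_num [e1, e2]
  · intro x hx
    have hx1 : 0 < 1 - x := by linarith [hx.2]
    have hx2 : 0 < 1 + x := by linarith [hx.1]
    have d1 : HasDerivAt (fun y : ℝ => (1 - y) ^ (α + 1)) (-1 * (α + 1) * (1 - x) ^ (α + 1 - 1)) x :=
      ((hasDerivAt_id x).const_sub 1).rpow_const (Or.inl hx1.ne')
    have d2 : HasDerivAt (fun y : ℝ => (1 + y) ^ β) (1 * β * (1 + x) ^ (β - 1)) x :=
      ((hasDerivAt_id x).const_add 1).rpow_const (Or.inl hx2.ne')
    have := (q.hasDerivAt x).mul (d1.mul d2)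
    refine this.congr_deriv ?_
    have e1 : (1 - x) ^ (α + 1) = (1 - x) ^ α * (1 - x) := Real.rpow_add_one hx1.ne' α
    rw [add_sub_cancel_right]
    simp only [Pi.add_apply, Pi.mul_apply, eval_mul, eval_sub, eval_one, eval_X, eval_C, e1]
    ring

lemma pos (α β : ℝ) (hα : 0 < α) (hβ : 0 < β) (p : ℝ[X]) (hp : p ≠ 0) :
    0 < ∫ y in (-1 : ℝ)..1, (p * p).eval y * ((1 - y) ^ α * (1 + y) ^ β) := by
  apply intervalIntegral.integral_pos (by norm_num) (cont α β hα hβ _).continuousOn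
  · intro x hx
    have hx1 : 0 ≤ 1 - x := by linarith [hx.2]
    have hx2 : 0 ≤ 1 + x := by linarith [hx.1]
    rw [eval_mul]
    exact mul_nonneg (mul_self_nonneg _) (by positivity)
  · obtain ⟨c, hc, hc'⟩ : ∃ c ∈ Set.Ioo (-1 : ℝ) 1, c ∉ p.roots.toFinset :=
      (Set.Ioo_infinite (by norm_num)).exists_notMem_finset _
    refine ⟨c, Set.Ioo_subset_Icc_self hc, ?_⟩
    have hx1 : 0 < 1 - c := by linarith [hc.2]
    have hx2 : 0 < 1 + c := by linarith [hc.1]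
    have : p.eval c ≠ 0 := by
      intro h0; apply hc'; simp [hp, h0]
    rw [eval_mul]
    exact mul_pos (mul_self_pos.2 this) (by positivity)

end JacobiAux

/-- Residues of the supplementary condition S₂ at `z = 1` and `z = -1`:
for every `n ≥ 1`, `(rₙ - r_{n+1} - 1)(1 - aₙ) = bₙ R_{n-1} - b_{n+1} R_{n+1}` and
`(rₙ - r_{n+1})(1 + aₙ) = b_{n+1} R_{n+1} - bₙ R_{n-1}`. -/
theorem jacobi_S2_residues
    (α β : ℝ) (hα : 0 < α) (hβ : 0 < β)
    (P : ℕ → Polynomial ℝ)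
    (hmonic : ∀ n, (P n).Monic) (hdeg : ∀ n, (P n).natDegree = n)
    (horth : ∀ m n : ℕ, m ≠ n →
      ∫ x in (-1 : ℝ)..1, (P m).eval x * (P n).eval x * ((1 - x) ^ α * (1 + x) ^ β) = 0)
    (h : ℕ → ℝ)
    (hh : ∀ n, h n = ∫ x in (-1 : ℝ)..1, ((P n).eval x) ^ 2 * ((1 - x) ^ α * (1 + x) ^ β))
    (a b : ℕ → ℝ)
    (hrec : ∀ n : ℕ, 1 ≤ n → ∀ x : ℝ,
      x * (P n).eval x = (P (n + 1)).eval x + a n * (P n).eval x + b n * (P (n - 1)).eval x)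
    (R r : ℕ → ℝ)
    (hR : ∀ n : ℕ, R n =
      (β / h n) * ∫ y in (-1 : ℝ)..1, ((P n).eval y) ^ 2 * ((1 - y) ^ α * (1 + y) ^ (β - 1)))
    (hr : ∀ n : ℕ, 1 ≤ n → r n =
      (β / h (n - 1)) * ∫ y in (-1 : ℝ)..1,
        (P n).eval y * (P (n - 1)).eval y * ((1 - y) ^ α * (1 + y) ^ (β - 1))) :
    ∀ n : ℕ, 1 ≤ n →
      ((r n - r (n + 1) - 1) * (1 - a n) = b n * R (n - 1) - b (n + 1) * R (n + 1))
      ∧ ((r n - r (n + 1)) * (1 + a n) = b (n + 1) * R (n + 1) - b n * R (n - 1)) := by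
  classical
  let L := JacobiAux.F (fun y => (1 - y) ^ α * (1 + y) ^ β)
    (fun q => (JacobiAux.cont α β hα hβ q).intervalIntegrable _ _)
  let M0 := JacobiAux.F (fun y => (1 - y) ^ α * (1 + y) ^ (β - 1))
    (fun q => JacobiAux.ii α β hα hβ q)
  have hL : ∀ q, L q = ∫ y in (-1 : ℝ)..1, q.eval y * ((1 - y) ^ α * (1 + y) ^ β) := fun _ => rfl
  have hM0 : ∀ q, M0 q = ∫ y in (-1 : ℝ)..1, q.eval y * ((1 - y) ^ α * (1 + y) ^ (β - 1)) :=
    fun _ => rfl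
  have hM1 : ∀ q, M0 ((1 + X) * q) = L q := by
    intro q
    rw [hL, hM0]
    apply intervalIntegral.integral_congr_ae
    refine Filter.Eventually.of_forall fun y hy => ?_
    rw [Set.uIoc_of_le (by norm_num)] at hy
    have hy2 : 0 < 1 + y := by linarith [hy.1]
    have e : (1 + y) ^ β = (1 + y) ^ (β - 1) * (1 + y) := by
      rw [← Real.rpow_add_one hy2.ne', sub_add_cancel]
    simp only [eval_mul, eval_add, eval_one, eval_X, e]
    ring
  have hI : ∀ q, β * M0 ((1 - X) * q) + L ((1 - X) * derivative q - C (α + 1) * q) = 0 :=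
    JacobiAux.ibp α β hα hβ
  have hLP : ∀ n, L (P n * P n) = h n := by
    intro n; rw [hL, hh]; simp only [eval_mul, sq]
  clear_value L M0
  intro n hn
  obtain ⟨m, rfl⟩ : ∃ m, n = m + 1 := ⟨n - 1, by omega⟩
  refine JacobiAux.core α β L (β • M0) P hmonic hdeg ?_ ?_ ?_ ?_ a b ?_ R r ?_ ?_ m
  · intro i j hij
    rw [hL, ← horth i j hij]
    simp only [eval_mul]
  · intro k
    rw [hL]
    exact (JacobiAux.pos α β hα hβ _ (hmonic k).ne_zero).ne'
  · intro q
    rw [LinearMap.smul_apply, hM1, smul_eq_mul]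
  · intro q
    have e1 := hI q
    have e2 := hM1 q
    have e3 : (1 - X) * q = (2 : ℝ) • q - (1 + X) * q := by
      rw [smul_eq_C_mul, C_ofNat]; ring
    rw [e3, map_sub, map_sub, map_smul, e2, ← smul_eq_C_mul, map_smul] at e1
    simp only [LinearMap.smul_apply, smul_eq_mul] at e1 ⊢
    linarith
  · intro k
    apply Polynomial.funext
    intro x
    have := hrec (k + 1) (by omega) x
    simpa using this
  · intro k
    rw [hR, hLP, LinearMap.smul_apply, hM0, smul_eq_mul]
    simp only [eval_mul, sq]
    ring
  · intro k
    rw [hr (k + 1) (by omega), hLP, LinearMap.smul_apply, hM0, smul_eq_mul]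
    simp only [eval_mul, Nat.add_sub_cancel]
    ring
end

section
/- The recurrence coefficients of the monic Jacobi polynomials satisfy the linear difference equation b_{n+1}(α + β + 2n + 3) − bₙ(α + β + 2n − 1) = 1 − aₙ² for every n ≥ 1. -/
open MeasureTheory Polynomial

/-- integrability of the Jacobi weight -/
lemma jacobi_weight_integrable (α β : ℝ) (hα : -1 < α) (hβ : -1 < β) :
    IntervalIntegrable (fun x : ℝ => (1 - x) ^ α * (1 + x) ^ β) volume (-1) 1 := by
  have h1 : IntervalIntegrable (fun x : ℝ => (1 + x) ^ β) volume (-1) 0 := by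
    have h := (intervalIntegral.intervalIntegrable_rpow' (a := 0) (b := 1) hβ).comp_add_left 1
    simpa using h
  have h2 : IntervalIntegrable (fun x : ℝ => (1 - x) ^ α) volume 0 1 := by
    have h := (intervalIntegral.intervalIntegrable_rpow' (a := 1) (b := 0) hα).comp_sub_left 1
    simpa using h
  refine IntervalIntegrable.trans (b := 0) ?_ ?_
  · refine h1.continuousOn_mul (g := fun x : ℝ => (1 - x) ^ α) ?_
    refine ContinuousOn.rpow_const (by fun_prop) ?_
    intro x hx
    rw [Set.uIcc_of_le (by norm_num)] at hx
    left
    have := hx.2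
    linarith
  · refine h2.mul_continuousOn (g := fun x : ℝ => (1 + x) ^ β) ?_
    refine ContinuousOn.rpow_const (by fun_prop) ?_
    intro x hx
    rw [Set.uIcc_of_le (by norm_num)] at hx
    left
    have := hx.1
    linarith

lemma jacobi_poly_integrable (α β : ℝ) (hα : -1 < α) (hβ : -1 < β) (p : Polynomial ℝ) :
    IntervalIntegrable (fun x : ℝ => p.eval x * ((1 - x) ^ α * (1 + x) ^ β)) volume (-1) 1 :=
  (jacobi_weight_integrable α β hα hβ).continuousOn_mul (g := fun x => p.eval x)
    p.continuous.continuousOn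

/-- the moment functional, as a linear map -/
lemma jacobi_functional (α β : ℝ) (hα : -1 < α) (hβ : -1 < β) :
    ∃ J : Polynomial ℝ →ₗ[ℝ] ℝ, ∀ p : Polynomial ℝ,
      J p = ∫ x in (-1 : ℝ)..1, p.eval x * ((1 - x) ^ α * (1 + x) ^ β) := by
  refine ⟨{ toFun := fun p => ∫ x in (-1 : ℝ)..1, p.eval x * ((1 - x) ^ α * (1 + x) ^ β)
            map_add' := ?_
            map_smul' := ?_ }, fun p => rfl⟩
  · intro p q
    rw [← intervalIntegral.integral_add (jacobi_poly_integrable α β hα hβ p)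
      (jacobi_poly_integrable α β hα hβ q)]
    congr 1
    ext x
    rw [eval_add]
    ring
  · intro c p
    simp only [eval_smul, smul_eq_mul, RingHom.id_apply, mul_assoc]
    rw [intervalIntegral.integral_const_mul]

/-- Pearson equation in integrated form -/
lemma jacobi_pearson (α β : ℝ) (hα : -1 < α) (hβ : -1 < β) (p : Polynomial ℝ) :
    ∫ x in (-1 : ℝ)..1, ((1 - X ^ 2) * derivative p
      + (C (β - α) - C (α + β + 2) * X) * p).eval x * ((1 - x) ^ α * (1 + x) ^ β) = 0 := by
  have key := intervalIntegral.integral_eq_sub_of_hasDerivAt_of_le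
    (a := (-1 : ℝ)) (b := 1)
    (f := fun x : ℝ => (1 - x) ^ (α + 1) * (1 + x) ^ (β + 1) * p.eval x)
    (f' := fun x : ℝ => ((1 - X ^ 2) * derivative p
      + (C (β - α) - C (α + β + 2) * X) * p).eval x * ((1 - x) ^ α * (1 + x) ^ β))
    (by norm_num) ?_ ?_ (jacobi_poly_integrable α β hα hβ _)
  · rw [key]
    have e1 : α + 1 ≠ 0 := by linarith
    have e2 : β + 1 ≠ 0 := by linarith
    simp [Real.zero_rpow e1, Real.zero_rpow e2]
  · refine ContinuousOn.mul (ContinuousOn.mul ?_ ?_) p.continuous.continuousOn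
    · exact ContinuousOn.rpow_const (by fun_prop) (fun x hx => Or.inr (by linarith))
    · exact ContinuousOn.rpow_const (by fun_prop) (fun x hx => Or.inr (by linarith))
  · intro x hx
    have hx1 : 0 < 1 - x := by have := hx.2; linarith
    have hx2 : 0 < 1 + x := by have := hx.1; linarith
    have d1 : HasDerivAt (fun x : ℝ => (1 - x) ^ (α + 1)) (-1 * (α + 1) * (1 - x) ^ (α + 1 - 1)) x :=
      ((hasDerivAt_id x).const_sub 1).rpow_const (Or.inl hx1.ne')
    have d2 : HasDerivAt (fun x : ℝ => (1 + x) ^ (β + 1)) (1 * (β + 1) * (1 + x) ^ (β + 1 - 1)) x :=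
      ((hasDerivAt_id x).const_add 1).rpow_const (Or.inl hx2.ne')
    have d3 := (d1.mul d2).mul (p.hasDerivAt x)
    refine d3.congr_deriv ?_
    simp only [Pi.mul_apply, add_sub_cancel_right, Real.rpow_add_one hx1.ne',
      Real.rpow_add_one hx2.ne', eval_add, eval_mul, eval_sub, eval_one, eval_pow, eval_X, eval_C]
    ring

lemma jacobi_norm_ne_zero (α β : ℝ) (hα : -1 < α) (hβ : -1 < β) (p : Polynomial ℝ) (hp : p ≠ 0) :
    ∫ x in (-1 : ℝ)..1, (p * p).eval x * ((1 - x) ^ α * (1 + x) ^ β) ≠ 0 := by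
  intro h
  have hint := jacobi_poly_integrable α β hα hβ (p * p)
  rw [intervalIntegral.integral_of_le (by norm_num), integral_Ioc_eq_integral_Ioo] at h
  rw [intervalIntegrable_iff_integrableOn_Ioo_of_le (by norm_num)] at hint
  have hnn : ∀ x ∈ Set.Ioo (-1 : ℝ) 1, 0 < (1 - x) ^ α * (1 + x) ^ β := by
    intro x hx
    have hx1 : 0 < 1 - x := by have := hx.2; linarith
    have hx2 : 0 < 1 + x := by have := hx.1; linarith
    positivity
  rw [setIntegral_eq_zero_iff_of_nonneg_ae ?_ hint] at h
  · have h' := (ae_restrict_iff' measurableSet_Ioo).1 h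
    have hfin : {x : ℝ | p.IsRoot x}.Finite := p.finite_setOfPred_isRoot hp
    have h0 : ∀ᵐ x : ℝ, x ∉ {x : ℝ | p.IsRoot x} :=
      measure_eq_zero_iff_ae_notMem.1 (hfin.measure_zero volume)
    have h1 : ∀ᵐ x : ℝ, x ∉ Set.Ioo (-1 : ℝ) 1 := by
      filter_upwards [h', h0] with x hx hx0 hmem
      have hz := hx hmem
      simp only [eval_mul, Pi.zero_apply] at hz
      rcases mul_eq_zero.1 hz with hz | hz
      · exact hx0 (mul_self_eq_zero.1 hz)
      · exact (hnn x hmem).ne' hz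
    have h2 := measure_eq_zero_iff_ae_notMem.2 h1
    rw [Real.volume_Ioo] at h2
    norm_num at h2
  · filter_upwards [ae_restrict_mem measurableSet_Ioo] with x hx
    have := hnn x hx
    simp only [eval_mul, Pi.zero_apply]
    exact mul_nonneg (mul_self_nonneg _) this.le

/-- the purely algebraic part -/
lemma jacobi_alg (α β : ℝ) (P : ℕ → Polynomial ℝ)
    (hmonic : ∀ n, (P n).Monic) (hdeg : ∀ n, (P n).natDegree = n)
    (J : Polynomial ℝ →ₗ[ℝ] ℝ)
    (horth : ∀ m n : ℕ, m ≠ n → J (P m * P n) = 0)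
    (hne : ∀ n, J (P n * P n) ≠ 0)
    (hpear : ∀ p, J ((1 - X ^ 2) * derivative p + (C (β - α) - C (α + β + 2) * X) * p) = 0)
    (a b : ℕ → ℝ)
    (hrec : ∀ m : ℕ, X * P (m + 1) = P (m + 2) + C (a (m + 1)) * P (m + 1) + C (b (m + 1)) * P m)
    (m : ℕ) :
    2 * (X * P (m + 1)).coeff m + (m + 1) - (P (m + 1)).coeff m ^ 2
      = (α + β + 2 * m + 3) * b (m + 1) := by
  have hJC : ∀ (c : ℝ) (p : Polynomial ℝ), J (C c * p) = c * J p := by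
    intro c p
    rw [← smul_eq_C_mul, map_smul, smul_eq_mul]
  have hlead : ∀ k, (P k).coeff k = 1 := by
    intro k
    have := hmonic k
    rw [Monic, leadingCoeff, hdeg] at this
    exact this
  have hhigh : ∀ k j, k < j → (P k).coeff j = 0 := by
    intro k j hj
    exact coeff_eq_zero_of_natDegree_lt (by rw [hdeg]; exact hj)
  have hlow : ∀ n k : ℕ, k ≤ n → ∀ p : Polynomial ℝ, (∀ j, k ≤ j → p.coeff j = 0) →
      J (p * P n) = 0 := by
    intro n k
    induction k with
    | zero =>
      intro _ p hp
      have : p = 0 := by ext j; simpa using hp j (Nat.zero_le _)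
      simp [this]
    | succ k ih =>
      intro hk p hp
      have h1 := ih (by omega) (p - C (p.coeff k) * P k) (by
        intro j hj
        rw [coeff_sub, coeff_C_mul]
        rcases hj.eq_or_lt with rfl | hj
        · rw [hlead]; ring
        · rw [hp j hj, hhigh k j hj]; ring)
      rw [sub_mul, map_sub, mul_assoc, hJC, horth k n (by omega)] at h1
      linarith
  set c := (P (m + 1)).coeff m with hc
  set e := (X * P (m + 1)).coeff m with he
  set B := b (m + 1) with hB
  have hcrec : (P (m + 2)).coeff (m + 1) = c - a (m + 1) := by
    have := congrArg (fun p => p.coeff (m + 1)) (hrec m)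
    simp only [coeff_X_mul, coeff_add, coeff_C_mul, hlead, hhigh m (m + 1) (by omega)] at this
    linarith
  have herec : (P (m + 2)).coeff m = e - a (m + 1) * c - B := by
    have := congrArg (fun p => p.coeff m) (hrec m)
    simp only [coeff_add, coeff_C_mul, hlead] at this
    linarith
  -- b h_m = h_{m+1}
  have hxm : J (X * P m * P (m + 1)) = J (P (m + 1) * P (m + 1)) := by
    have := hlow (m + 1) (m + 1) le_rfl (X * P m - P (m + 1)) (by
      intro j hj
      obtain ⟨j, rfl⟩ : ∃ i, j = i + 1 := ⟨j - 1, by omega⟩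
      rw [coeff_sub, coeff_X_mul]
      rcases hj.eq_or_lt with h | h
      · have : j = m := by omega
        subst this
        rw [hlead, hlead]; ring
      · rw [hhigh _ _ (by omega), hhigh _ _ (by omega)]; ring)
    rw [sub_mul, map_sub] at this
    linarith
  have hbm : J (X * P m * P (m + 1)) = B * J (P m * P m) := by
    have : X * P m * P (m + 1) = P (m + 2) * P m + C (a (m + 1)) * (P (m + 1) * P m)
        + C B * (P m * P m) := by
      have h := hrec m
      linear_combination P m * h
    rw [this, map_add, map_add, hJC, hJC, horth _ _ (by omega), horth _ _ (by omega)]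
    ring
  -- derivative coefficients
  have hX2 : ∀ k j, ((1 - X ^ 2) * derivative (P k)).coeff j
      = (P k).coeff (j + 1) * (j + 1) - ((X * P k).coeff j * (j + 1) - 2 * (X * P k).coeff j) := by
    intro k j
    have h : (1 - X ^ 2) * derivative (P k)
        = derivative (P k) - (derivative (X * (X * P k)) - C 2 * (X * P k)) := by
      simp only [derivative_mul, derivative_X, map_ofNat]
      ring
    rw [h, coeff_sub, coeff_sub, coeff_derivative, coeff_derivative, coeff_C_mul, coeff_X_mul]
  have hD1 : J ((1 - X ^ 2) * derivative (P m) * P (m + 1)) = -m * J (P (m + 1) * P (m + 1)) := by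
    have := hlow (m + 1) (m + 1) le_rfl ((1 - X ^ 2) * derivative (P m) - C (-m : ℝ) * P (m + 1)) (by
      intro j hj
      obtain ⟨j, rfl⟩ : ∃ i, j = i + 1 := ⟨j - 1, by omega⟩
      rw [coeff_sub, coeff_C_mul, hX2, coeff_X_mul, hhigh m (j + 1 + 1) (by omega)]
      rcases hj.eq_or_lt with h | h
      · have : j = m := by omega
        subst this
        rw [hlead, hlead]; push_cast; ring
      · rw [hhigh _ _ (by omega), hhigh _ _ (by omega)]; ring)
    rw [sub_mul, map_sub, mul_assoc (C _), hJC] at this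
    linarith
  set u : ℝ := (m + 1) * (c - a (m + 1)) - m * c with hu
  set K : ℝ := (m + 1) - (m - 1) * e + (m + 1) * (e - a (m + 1) * c - B) - u * c with hK
  have hD2 : J ((1 - X ^ 2) * derivative (P (m + 1)) * P m) = K * J (P m * P m) := by
    have := hlow m m le_rfl ((1 - X ^ 2) * derivative (P (m + 1)) - C (-(m + 1) : ℝ) * P (m + 2)
        - C u * P (m + 1) - C K * P m) (by
      intro j hj
      simp only [coeff_sub, coeff_C_mul, hX2]
      obtain rfl | rfl | rfl | h : j = m ∨ j = m + 1 ∨ j = m + 2 ∨ m + 2 < j := by omega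
      · rw [← he, ← hc, herec, hlead, hlead, hK]; ring
      · rw [coeff_X_mul, ← hc, hcrec, hlead, hhigh _ _ (by omega), hhigh _ _ (by omega), hu]
        push_cast; ring
      · rw [coeff_X_mul, hlead, hlead, hhigh _ _ (by omega), hhigh _ _ (by omega),
          hhigh _ _ (by omega)]
        push_cast; ring
      · obtain ⟨i, rfl⟩ : ∃ i, j = i + 1 := ⟨j - 1, by omega⟩
        rw [coeff_X_mul, hhigh _ _ (by omega), hhigh _ _ (by omega), hhigh _ _ (by omega),
          hhigh _ _ (by omega), hhigh _ _ (by omega)]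
        ring)
    simp only [sub_mul, map_sub, mul_assoc (C _), hJC] at this
    rw [horth (m + 2) m (by omega), horth (m + 1) m (by omega)] at this
    rw [sub_mul, sub_mul, map_sub]
    linarith
  have hp := hpear (P (m + 1) * P m)
  have hexp : (1 - X ^ 2) * derivative (P (m + 1) * P m)
      + (C (β - α) - C (α + β + 2) * X) * (P (m + 1) * P m)
      = (1 - X ^ 2) * derivative (P (m + 1)) * P m + (1 - X ^ 2) * derivative (P m) * P (m + 1)
        + C (β - α) * (P (m + 1) * P m) - C (α + β + 2) * (X * P m * P (m + 1)) := by
    rw [derivative_mul]; ring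
  rw [hexp, map_sub, map_add, map_add, hJC, hJC, hD1, hD2, horth (m + 1) m (by omega), ← hxm, hbm] at hp
  have hz : (K - m * B - (α + β + 2) * B) * J (P m * P m) = 0 := by linarith
  rcases mul_eq_zero.1 hz with hz | hz
  · rw [hK, hu] at hz
    linarith
  · exact absurd hz (hne m)

/-- the recurrence coefficients of the monic Jacobi polynomials satisfy
`b_{n+1}(α + β + 2n + 3) - bₙ(α + β + 2n - 1) = 1 - aₙ²` for every `n ≥ 1`. -/
theorem jacobi_bn_difference_equation
    (α β : ℝ) (hα : -1 < α) (hβ : -1 < β)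
    (P : ℕ → Polynomial ℝ)
    (hmonic : ∀ n, (P n).Monic) (hdeg : ∀ n, (P n).natDegree = n)
    (horth : ∀ m n : ℕ, m ≠ n →
      ∫ x in (-1 : ℝ)..1, (P m).eval x * (P n).eval x * ((1 - x) ^ α * (1 + x) ^ β) = 0)
    (a b : ℕ → ℝ)
    (hrec : ∀ n : ℕ, 1 ≤ n → ∀ x : ℝ,
      x * (P n).eval x = (P (n + 1)).eval x + a n * (P n).eval x + b n * (P (n - 1)).eval x) :
    ∀ n : ℕ, 1 ≤ n →
      b (n + 1) * (α + β + 2 * (n : ℝ) + 3) - b n * (α + β + 2 * (n : ℝ) - 1)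
        = 1 - (a n) ^ 2 := by
  obtain ⟨J, hJ⟩ := jacobi_functional α β hα hβ
  have hrec' : ∀ m : ℕ,
      X * P (m + 1) = P (m + 2) + C (a (m + 1)) * P (m + 1) + C (b (m + 1)) * P m := by
    intro m
    refine Polynomial.funext fun x => ?_
    simpa using hrec (m + 1) (by omega) x
  have halg := jacobi_alg α β P hmonic hdeg J
    (fun m n hmn => by rw [hJ]; simpa only [eval_mul] using horth m n hmn)
    (fun n => by rw [hJ]; exact jacobi_norm_ne_zero α β hα hβ _ (hmonic n).ne_zero)
    (fun p => by rw [hJ]; exact jacobi_pearson α β hα hβ p) a b hrec'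
  intro n hn
  obtain ⟨m, rfl⟩ : ∃ m, n = m + 1 := ⟨n - 1, by omega⟩
  have hlead : ∀ k, (P k).coeff k = 1 := by
    intro k
    have := hmonic k
    rw [Monic, leadingCoeff, hdeg] at this
    exact this
  have h1 := halg m
  have h2 := halg (m + 1)
  have hcrec : (P (m + 2)).coeff (m + 1) = (P (m + 1)).coeff m - a (m + 1) := by
    have := congrArg (fun p => p.coeff (m + 1)) (hrec' m)
    have h0 : (P m).coeff (m + 1) = 0 :=
      coeff_eq_zero_of_natDegree_lt (by rw [hdeg]; omega)
    simp only [coeff_X_mul, coeff_add, coeff_C_mul, hlead, h0] at this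
    linarith
  have herec : (P (m + 2)).coeff m
      = (X * P (m + 1)).coeff m - a (m + 1) * (P (m + 1)).coeff m - b (m + 1) := by
    have := congrArg (fun p => p.coeff m) (hrec' m)
    simp only [coeff_add, coeff_C_mul, hlead] at this
    linarith
  rw [coeff_X_mul, show m + 1 + 1 = m + 2 from rfl, hcrec, herec] at h2
  push_cast at h2 ⊢
  linear_combination h1 - h2
end
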